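/- arXiv:1812.11368 — 2 statements merged into one kernel-verified Lean document; each statement's English description precedes it below -/
import Mathlib

section
/- Let α ∈ (0,1), let a be an integer, let κ be a positive integer, let y : ℤ → ℝ^κ, and let P be a symmetric positive definite real κ×κ matrix. Then for every integer k ≥ a, ᴿ∇ᵃ_k^α (j ↦ y(j)ᵀ P y(j)) ≤ 2 · y(k)ᵀ P (ᴿ∇ᵃ_k^α y), where the fractional difference of the vector-valued function y is taken componentwise. -/
open Matrix

noncomputable def nablaRL (α : ℝ) (a : ℤ) (f : ℤ → ℝ) (k : ℤ) : ℝ :=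
  (∑ j ∈ Finset.Icc a k,
    Real.Gamma (((k - j : ℤ) : ℝ) + 1 - α) /
      (Real.Gamma (1 - α) * Real.Gamma (((k - j : ℤ) : ℝ) + 1)) * f j) -
  ∑ j ∈ Finset.Icc a (k - 1),
    Real.Gamma (((k - j : ℤ) : ℝ) - α) /
      (Real.Gamma (1 - α) * Real.Gamma (((k - j : ℤ) : ℝ))) * f j

/-- The normalised kernel `Γ(x + 1 - α) / (Γ(1 - α) Γ(x + 1))` of the fractional difference. -/
noncomputable def rlKernel (α x : ℝ) : ℝ :=
  Real.Gamma (x + 1 - α) / (Real.Gamma (1 - α) * Real.Gamma (x + 1))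

theorem rlKernel_zero {α : ℝ} (hα : α < 1) : rlKernel α 0 = 1 := by
  have h : Real.Gamma (1 - α) ≠ 0 := (Real.Gamma_pos_of_pos (by linarith)).ne'
  simp [rlKernel, h]

theorem rlKernel_pos {α x : ℝ} (hα : α < 1) (hx : 0 ≤ x) : 0 < rlKernel α x :=
  div_pos (Real.Gamma_pos_of_pos (by linarith))
    (mul_pos (Real.Gamma_pos_of_pos (by linarith)) (Real.Gamma_pos_of_pos (by linarith)))

theorem rlKernel_add_one {α x : ℝ} (hα : α < 1) (hx : 0 ≤ x) :
    rlKernel α (x + 1) = rlKernel α x * ((x + 1 - α) / (x + 1)) := by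
  have h₁ : x + 1 - α ≠ 0 := by linarith
  have h₂ : x + 1 ≠ 0 := by linarith
  unfold rlKernel
  rw [show x + 1 + 1 - α = (x + 1 - α) + 1 by ring, Real.Gamma_add_one h₁, Real.Gamma_add_one h₂]
  have h₃ : Real.Gamma (1 - α) ≠ 0 := (Real.Gamma_pos_of_pos (by linarith)).ne'
  have h₄ : Real.Gamma (x + 1) ≠ 0 := (Real.Gamma_pos_of_pos (by linarith)).ne'
  field_simp

theorem rlKernel_add_one_le {α x : ℝ} (hα0 : 0 ≤ α) (hα1 : α < 1) (hx : 0 ≤ x) :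
    rlKernel α (x + 1) ≤ rlKernel α x := by
  rw [rlKernel_add_one hα1 hx]
  refine mul_le_of_le_one_right (rlKernel_pos hα1 hx).le ?_
  rw [div_le_one (by linarith)]
  linarith

/-- The weight of `f j` in the fractional difference of `f` at `k`, up to sign. -/
noncomputable def rlWeight (α : ℝ) (k j : ℤ) : ℝ :=
  rlKernel α ((k - j : ℤ) - 1) - rlKernel α (k - j : ℤ)

theorem rlWeight_nonneg {α : ℝ} (hα0 : 0 ≤ α) (hα1 : α < 1) {k j : ℤ} (hj : j < k) :
    0 ≤ rlWeight α k j := by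
  have hx : (0 : ℝ) ≤ ((k - j : ℤ) : ℝ) - 1 := by
    have : (1 : ℤ) ≤ k - j := by omega
    have : (1 : ℝ) ≤ ((k - j : ℤ) : ℝ) := by exact_mod_cast this
    linarith
  have h := rlKernel_add_one_le hα0 hα1 hx
  rw [sub_add_cancel] at h
  exact sub_nonneg.2 h

theorem Int.Icc_eq_insert_Icc_sub_one {a k : ℤ} (hk : a ≤ k) :
    Finset.Icc a k = insert k (Finset.Icc a (k - 1)) := by
  ext j
  simp only [Finset.mem_insert, Finset.mem_Icc]
  omega

theorem sum_rlWeight (α : ℝ) (k : ℤ) {a m : ℤ} (hm : a - 1 ≤ m) :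
    ∑ j ∈ Finset.Icc a m, rlWeight α k j =
      rlKernel α ((k - m : ℤ) - 1) - rlKernel α (k - a : ℤ) := by
  induction m, hm using Int.leInduction with
  | base =>
    rw [Finset.Icc_eq_empty (by omega)]
    push_cast
    rw [show (k : ℝ) - (a - 1) - 1 = k - a by ring]
    simp
  | succ m hm ih =>
    rw [Int.Icc_eq_insert_Icc_sub_one (by omega), Finset.sum_insert (by simp),
      add_sub_cancel_right, ih, rlWeight]
    push_cast
    rw [show (k : ℝ) - (m + 1) = k - m - 1 by ring]
    ring

theorem sum_rlWeight_le_one {α : ℝ} (hα : α < 1) {a k : ℤ} (hk : a ≤ k) :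
    ∑ j ∈ Finset.Icc a (k - 1), rlWeight α k j ≤ 1 := by
  rw [sum_rlWeight α k (by omega)]
  have h : (0 : ℝ) ≤ ((k - a : ℤ) : ℝ) := by exact_mod_cast sub_nonneg.2 hk
  have h₀ : (((k - (k - 1) : ℤ) : ℝ) - 1) = 0 := by push_cast; ring
  rw [h₀, rlKernel_zero hα]
  linarith [rlKernel_pos hα h]

theorem nablaRL_eq_sub_sum {α : ℝ} (hα : α < 1) {a k : ℤ} (hk : a ≤ k) (f : ℤ → ℝ) :
    nablaRL α a f k = f k - ∑ j ∈ Finset.Icc a (k - 1), rlWeight α k j * f j := by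
  have h := rlKernel_zero hα
  unfold nablaRL
  rw [Int.Icc_eq_insert_Icc_sub_one hk, Finset.sum_insert (by simp), add_sub_assoc,
    ← Finset.sum_sub_distrib, sub_eq_add_neg (f k), ← Finset.sum_neg_distrib]
  congr 1
  · rw [sub_self, Int.cast_zero]
    change rlKernel α 0 * f k = f k
    rw [h, one_mul]
  · refine Finset.sum_congr rfl fun j _ => ?_
    simp only [rlWeight, rlKernel, sub_add_cancel]
    ring

theorem nablaRL_pi {α : ℝ} (hα : α < 1) {a k : ℤ} (hk : a ≤ k) {κ : ℕ}
    (y : ℤ → Fin κ → ℝ) :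
    (fun i => nablaRL α a (fun j => y j i) k) =
      y k - ∑ j ∈ Finset.Icc a (k - 1), rlWeight α k j • y j := by
  ext i
  simp [nablaRL_eq_sub_sum hα hk, Finset.sum_apply]

theorem nablaR_quadratic (α : ℝ) (hα0 : 0 < α) (hα1 : α < 1) (a : ℤ)
    (κ : ℕ) (hκ : 0 < κ) (y : ℤ → Fin κ → ℝ) (P : Matrix (Fin κ) (Fin κ) ℝ)
    (hPsymm : P.IsSymm) (hP : P.PosDef) (k : ℤ) (hk : a ≤ k) :
    nablaRL α a (fun j => y j ⬝ᵥ P.mulVec (y j)) k ≤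
      2 * (y k ⬝ᵥ P.mulVec (fun i => nablaRL α a (fun j => y j i) k)) := by
  have hsymm : ∀ u v : Fin κ → ℝ, u ⬝ᵥ P.mulVec v = v ⬝ᵥ P.mulVec u := fun u v => by
    rw [dotProduct_mulVec, ← mulVec_transpose, hPsymm.eq, dotProduct_comm]
  have hnonneg : ∀ u : Fin κ → ℝ, 0 ≤ u ⬝ᵥ P.mulVec u := fun u => by
    simpa using hP.posSemidef.dotProduct_mulVec_nonneg u
  have hsum : 0 ≤ ∑ j ∈ Finset.Icc a (k - 1),
      rlWeight α k j * ((y k - y j) ⬝ᵥ P.mulVec (y k - y j)) :=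
    Finset.sum_nonneg fun j hj => mul_nonneg
      (rlWeight_nonneg hα0.le hα1 (by have := Finset.mem_Icc.1 hj; omega)) (hnonneg _)
  have hexpand : ∑ j ∈ Finset.Icc a (k - 1),
        rlWeight α k j * ((y k - y j) ⬝ᵥ P.mulVec (y k - y j)) =
      (∑ j ∈ Finset.Icc a (k - 1), rlWeight α k j) * (y k ⬝ᵥ P.mulVec (y k)) -
        2 * ∑ j ∈ Finset.Icc a (k - 1), rlWeight α k j * (y k ⬝ᵥ P.mulVec (y j)) +
        ∑ j ∈ Finset.Icc a (k - 1), rlWeight α k j * (y j ⬝ᵥ P.mulVec (y j)) := by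
    rw [Finset.sum_mul, Finset.mul_sum, ← Finset.sum_sub_distrib, ← Finset.sum_add_distrib]
    refine Finset.sum_congr rfl fun j _ => ?_
    rw [mulVec_sub, sub_dotProduct, dotProduct_sub, dotProduct_sub, hsymm (y j) (y k)]
    ring
  have hcross : y k ⬝ᵥ P.mulVec (∑ j ∈ Finset.Icc a (k - 1), rlWeight α k j • y j) =
      ∑ j ∈ Finset.Icc a (k - 1), rlWeight α k j * (y k ⬝ᵥ P.mulVec (y j)) := by
    simp only [mulVec_sum, dotProduct_sum, mulVec_smul, dotProduct_smul, smul_eq_mul]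
  rw [nablaRL_pi hα1 hk y, nablaRL_eq_sub_sum hα1 hk, mulVec_sub, dotProduct_sub,
    hcross]
  have hrest := mul_nonneg (sub_nonneg.2 (sum_rlWeight_le_one hα1 hk)) (hnonneg (y k))
  linarith
end

section
/- Let α ∈ (0,1), let a be an integer, let m be a positive integer, and let x : ℤ → ℝ. Then for every integer k ≥ a, ᴳ∇ᵃ_k^α (x^{2^m}) ≤ 2^m · x(k)^{2^m − 1} · ᴳ∇ᵃ_k^α x, where x^p denotes the function j ↦ x(j)^p. -/
noncomputable def nablaGL (α : ℝ) (a : ℤ) (f : ℤ → ℝ) (k : ℤ) : ℝ :=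
  ∑ j ∈ Finset.Icc (0 : ℤ) (k - a),
    Real.Gamma ((j : ℝ) - α) / (Real.Gamma (-α) * Real.Gamma ((j : ℝ) + 1)) * f (k - j)

/-- The tangent-line inequality for the convex function `t ↦ t ^ (2 ^ (m + 1))`. -/
theorem tangent_le_pow_two_pow (m : ℕ) (y t : ℝ) :
    (2 : ℝ) ^ (m + 1) * y ^ (2 ^ (m + 1) - 1) * t ≤
      t ^ (2 ^ (m + 1)) + ((2 : ℝ) ^ (m + 1) - 1) * y ^ (2 ^ (m + 1)) := by
  induction m with
  | zero =>
    norm_num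
    nlinarith [sq_nonneg (t - y)]
  | succ m ih =>
    have hpos : 0 < 2 ^ (m + 1) := by positivity
    have he : 2 ^ (m + 1 + 1) - 1 = 2 ^ (m + 1) + (2 ^ (m + 1) - 1) := by
      rw [pow_succ 2 (m + 1)]
      omega
    have hy : 0 ≤ y ^ (2 ^ (m + 1)) :=
      (Even.pow_of_ne_zero even_two (Nat.succ_ne_zero m)).pow_nonneg y
    rw [he, pow_add y, pow_succ (2 : ℕ) (m + 1), pow_succ (2 : ℝ) (m + 1), pow_mul, pow_mul]
    have h := mul_le_mul_of_nonneg_left ih hy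
    nlinarith [sq_nonneg (t ^ (2 ^ (m + 1)) - y ^ (2 ^ (m + 1)))]

theorem Int.sum_Icc_zero_natCast (F : ℤ → ℝ) (n : ℕ) :
    ∑ j ∈ Finset.Icc (0 : ℤ) n, F j = ∑ i ∈ Finset.range (n + 1), F i := by
  refine Finset.sum_nbij' Int.toNat (fun i => (i : ℤ)) ?_ ?_ ?_ ?_ ?_
  · intro j hj
    simp only [Finset.mem_Icc, Finset.mem_range] at *
    omega
  · intro j hj
    simp only [Finset.mem_Icc, Finset.mem_range] at *
    omega
  · intro j hj
    simp only [Finset.mem_Icc] at hj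
    exact Int.toNat_of_nonneg hj.1
  · intro j _
    simp
  · intro j hj
    simp only [Finset.mem_Icc] at hj
    rw [Int.toNat_of_nonneg hj.1]

/-- The coefficient of `f (k - i)` in the Grünwald–Letnikov difference of order `α`. -/
noncomputable def glWeight (α : ℝ) (i : ℕ) : ℝ :=
  Real.Gamma ((i : ℝ) - α) / (Real.Gamma (-α) * Real.Gamma ((i : ℝ) + 1))

theorem nablaGL_add_natCast (α : ℝ) (a : ℤ) (f : ℤ → ℝ) (n : ℕ) :
    nablaGL α a f (a + n) =
      ∑ i ∈ Finset.range (n + 1), glWeight α i * f (a + n - i) := by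
  rw [nablaGL, add_sub_cancel_left, Int.sum_Icc_zero_natCast]
  simp [glWeight]

theorem Real.Gamma_one_sub_eq {α : ℝ} (hα0 : 0 < α) :
    Real.Gamma (1 - α) = -α * Real.Gamma (-α) := by
  rw [← Real.Gamma_add_one (neg_ne_zero.mpr hα0.ne')]
  ring_nf

theorem Real.Gamma_neg_lt_zero {α : ℝ} (hα0 : 0 < α) (hα1 : α < 1) :
    Real.Gamma (-α) < 0 := by
  have h1 : 0 < Real.Gamma (1 - α) := Real.Gamma_pos_of_pos (by linarith)
  rw [Real.Gamma_one_sub_eq hα0] at h1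
  nlinarith

theorem glWeight_succ_nonpos {α : ℝ} (hα0 : 0 < α) (hα1 : α < 1) (i : ℕ) :
    glWeight α (i + 1) ≤ 0 := by
  have hi : (0 : ℝ) ≤ i := i.cast_nonneg
  refine div_nonpos_of_nonneg_of_nonpos (Real.Gamma_nonneg_of_nonneg ?_) ?_
  · push_cast
    linarith
  · exact mul_nonpos_of_nonpos_of_nonneg (Real.Gamma_neg_lt_zero hα0 hα1).le
      (Real.Gamma_nonneg_of_nonneg (by positivity))

theorem sum_glWeight {α : ℝ} (hα0 : 0 < α) (hα1 : α < 1) (n : ℕ) :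
    ∑ i ∈ Finset.range (n + 1), glWeight α i =
      Real.Gamma (n + 1 - α) / (Real.Gamma (1 - α) * Real.Gamma (n + 1)) := by
  have hG := (Real.Gamma_neg_lt_zero hα0 hα1).ne
  rw [Real.Gamma_one_sub_eq hα0]
  induction n with
  | zero =>
    have h1 := Real.Gamma_one_sub_eq hα0
    simp [glWeight, h1, hG, hα0.ne']
  | succ n ih =>
    have hn : (0 : ℝ) ≤ n := n.cast_nonneg
    have hF : Real.Gamma ((n : ℝ) + 1) ≠ 0 := (Real.Gamma_pos_of_pos (by positivity)).ne'
    have hn1 : (n : ℝ) + 1 ≠ 0 := by positivity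
    have hN : Real.Gamma ((n : ℝ) + 1 + 1 - α) = (n + 1 - α) * Real.Gamma (n + 1 - α) := by
      rw [← Real.Gamma_add_one (by linarith)]
      ring_nf
    rw [Finset.sum_range_succ, ih, glWeight]
    push_cast
    rw [hN, Real.Gamma_add_one hn1]
    field_simp
    ring

theorem sum_glWeight_nonneg {α : ℝ} (hα0 : 0 < α) (hα1 : α < 1) (n : ℕ) :
    0 ≤ ∑ i ∈ Finset.range (n + 1), glWeight α i := by
  have hn : (0 : ℝ) ≤ n := n.cast_nonneg
  rw [sum_glWeight hα0 hα1]
  exact div_nonneg (Real.Gamma_nonneg_of_nonneg (by linarith))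
    (mul_nonneg (Real.Gamma_nonneg_of_nonneg (by linarith))
      (Real.Gamma_nonneg_of_nonneg (by positivity)))

theorem nablaG_pow_two_pow (α : ℝ) (hα0 : 0 < α) (hα1 : α < 1) (a : ℤ)
    (m : ℕ) (hm : 0 < m) (x : ℤ → ℝ) (k : ℤ) (hk : a ≤ k) :
    nablaGL α a (fun j => x j ^ (2 ^ m)) k ≤
      (2 : ℝ) ^ m * x k ^ (2 ^ m - 1) * nablaGL α a x k := by
  obtain ⟨n, rfl⟩ := Int.le.dest hk
  obtain ⟨m, rfl⟩ := Nat.exists_eq_succ_of_ne_zero hm.ne'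
  rw [Nat.succ_eq_add_one, nablaGL_add_natCast, nablaGL_add_natCast]
  set y := x (a + n) with hy
  have hy0 : 0 ≤ ((2 : ℝ) ^ (m + 1) - 1) * y ^ (2 ^ (m + 1)) :=
    mul_nonneg (sub_nonneg.mpr (one_le_pow₀ one_le_two))
      ((Even.pow_of_ne_zero even_two (Nat.succ_ne_zero m)).pow_nonneg y)
  have hsum := mul_nonneg (sum_glWeight_nonneg hα0 hα1 n) hy0
  rw [Finset.sum_mul] at hsum
  rw [← sub_nonneg, Finset.mul_sum, ← Finset.sum_sub_distrib]
  refine hsum.trans (Finset.sum_le_sum fun i _ => ?_)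
  cases i with
  | zero =>
    have hp : y ^ (2 ^ (m + 1)) = y ^ (2 ^ (m + 1) - 1) * y :=
      (pow_sub_one_mul (by positivity) y).symm
    simp only [Nat.cast_zero, sub_zero, ← hy]
    rw [hp]
    exact le_of_eq (by ring)
  | succ i =>
    have h := mul_le_mul_of_nonpos_left
      (tangent_le_pow_two_pow m y (x (a + n - (i + 1 : ℕ)))) (glWeight_succ_nonpos hα0 hα1 i)
    linarith
end
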